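/- Let f be in the class F and let x_N be generated by GOGM (with parameters θ_i satisfying θ_0 = 1, θ_i > 0, and θ_i² ≤ Θ_i, where Θ_i = Σ_{l=0}^{i} θ_l for i ≤ N−1 and Θ_N = 2Σ_{l=0}^{N−1} θ_l + θ_N). Then f(x_N) − f(x_*) ≤ L·R² / (2Θ_N). -/

import Mathlib

/-!
# Worst-case rate of the generalized optimized gradient method

The proof combines the interpolation inequality of smooth convex functions with a Lyapunov function
built on the auxiliary sequence `z (i + 1) = z i - (2 * θ i / L) • ∇f (x i)`, in terms of which
`x i` is a convex combination of `y i` and `z i`.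
-/

open scoped RealInnerProductSpace

section SmoothConvex

variable {E : Type*} [NormedAddCommGroup E] [InnerProductSpace ℝ E] [CompleteSpace E]
  {f : E → ℝ} {f' : E → E}

lemma HasGradientAt.hasDerivAt_comp_add_smul {u v g : E} {t : ℝ}
    (h : HasGradientAt f g (u + t • v)) :
    HasDerivAt (fun s : ℝ => f (u + s • v)) ⟪g, v⟫ t := by
  have hline : HasDerivAt (fun s : ℝ => u + s • v) v t := by
    simpa using ((hasDerivAt_id t).smul_const v).const_add u
  simpa [Function.comp_def] using h.hasFDerivAt.comp_hasDerivAt t hline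

/-- A convex function lies above its tangent hyperplanes. -/
lemma ConvexOn.add_inner_gradient_le (hconv : ConvexOn ℝ Set.univ f) {u g : E}
    (hdiff : HasGradientAt f g u) (v : E) : f u + ⟪g, v - u⟫ ≤ f v := by
  have hderiv : HasDerivAt (fun s : ℝ => f (u + s • (v - u))) ⟪g, v - u⟫ 0 :=
    HasGradientAt.hasDerivAt_comp_add_smul (by simpa using hdiff)
  have hline : ConvexOn ℝ Set.univ (fun s : ℝ => f (u + s • (v - u))) := by
    simpa [Function.comp_def, AffineMap.lineMap_apply, add_comm] using
      hconv.comp_affineMap (AffineMap.lineMap (k := ℝ) u v)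
  have := hline.le_slope_of_hasDerivAt (Set.mem_univ 0) (Set.mem_univ 1) one_pos hderiv
  simp [slope_def_field] at this
  linarith

/-- The descent lemma: a function with `L`-Lipschitz gradient lies below the quadratic upper models
given by its first-order expansions. -/
lemma le_add_inner_gradient_add_sq {L : ℝ} (hdiff : ∀ z, HasGradientAt f (f' z) z)
    (hlip : ∀ z w, ‖f' z - f' w‖ ≤ L * ‖z - w‖) (u v : E) :
    f v ≤ f u + ⟪f' u, v - u⟫ + L / 2 * ‖v - u‖ ^ 2 := by
  have hf (t : ℝ) : HasDerivAt (fun s : ℝ => f (u + s • (v - u))) ⟪f' (u + t • (v - u)), v - u⟫ t :=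
    (hdiff _).hasDerivAt_comp_add_smul
  have hB (t : ℝ) : HasDerivAt
      (fun s : ℝ => f u + s * ⟪f' u, v - u⟫ + s ^ 2 * (L / 2 * ‖v - u‖ ^ 2))
      (⟪f' u, v - u⟫ + t * (L * ‖v - u‖ ^ 2)) t := by
    refine ((((hasDerivAt_id t).mul_const ⟪f' u, v - u⟫).const_add (f u)).add
      ((hasDerivAt_pow 2 t).mul_const (L / 2 * ‖v - u‖ ^ 2))).congr_deriv ?_
    norm_num
    ring
  have key := image_le_of_deriv_right_le_deriv_boundary (a := 0) (b := 1)
    (fun t _ => (hf t).continuousAt.continuousWithinAt)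
    (fun t _ => (hf t).hasDerivWithinAt) (by simp)
    (fun t _ => (hB t).continuousAt.continuousWithinAt)
    (fun t _ => (hB t).hasDerivWithinAt)
    (fun t ht => ?_) (Set.right_mem_Icc.2 zero_le_one)
  · simpa using key
  · have h1 : ⟪f' (u + t • (v - u)) - f' u, v - u⟫ ≤ t * (L * ‖v - u‖ ^ 2) := by
      calc _ ≤ ‖f' (u + t • (v - u)) - f' u‖ * ‖v - u‖ := real_inner_le_norm _ _
        _ ≤ L * ‖u + t • (v - u) - u‖ * ‖v - u‖ := by gcongr; exact hlip _ _
        _ = _ := by rw [add_sub_cancel_left, norm_smul, Real.norm_of_nonneg ht.1]; ring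
    rw [inner_sub_left] at h1
    linarith

/-- The interpolation inequality of convex functions with `L`-Lipschitz gradient. -/
lemma ConvexOn.add_inner_gradient_add_sq_le {L : ℝ} (hL : 0 < L) (hconv : ConvexOn ℝ Set.univ f)
    (hdiff : ∀ z, HasGradientAt f (f' z) z)
    (hlip : ∀ z w, ‖f' z - f' w‖ ≤ L * ‖z - w‖) (u v : E) :
    f u + ⟪f' u, v - u⟫ + ‖f' v - f' u‖ ^ 2 / (2 * L) ≤ f v := by
  set p := f' v - f' u with hp
  have hlow := hconv.add_inner_gradient_le (hdiff u) (v - (1 / L) • p)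
  have hupp := le_add_inner_gradient_add_sq hdiff hlip v (v - (1 / L) • p)
  have hpp : ⟪f' v, p⟫ - ⟪f' u, p⟫ = ‖p‖ ^ 2 := by
    rw [← inner_sub_left, ← hp, real_inner_self_eq_norm_sq]
  rw [sub_right_comm, inner_sub_right, real_inner_smul_right] at hlow
  rw [sub_sub_cancel_left, inner_neg_right, real_inner_smul_right, norm_neg, norm_smul,
    Real.norm_of_nonneg (by positivity)] at hupp
  have hquad : L / 2 * (1 / L * ‖p‖) ^ 2 = 1 / L * ‖p‖ ^ 2 - ‖p‖ ^ 2 / (2 * L) := by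
    field_simp
    ring
  rw [hquad, ← hpp] at hupp
  rw [← hpp]
  linarith

end SmoothConvex

section InnerProduct

variable {E : Type*} [NormedAddCommGroup E] [InnerProductSpace ℝ E]

lemma half_mul_norm_sub_smul_sub_sq {L : ℝ} (hL : L ≠ 0) (θ : ℝ) (z w g : E) :
    L / 2 * ‖z - (2 * θ / L) • g - w‖ ^ 2 =
      L / 2 * ‖z - w‖ ^ 2 - 2 * θ * ⟪g, z - w⟫ + 2 * θ ^ 2 * ‖g‖ ^ 2 / L := by
  rw [sub_right_comm, norm_sub_sq_real, real_inner_smul_right, norm_smul, mul_pow,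
    Real.norm_eq_abs, sq_abs, real_inner_comm]
  field_simp

lemma mul_inner_le_half_mul_norm_sq_add {L : ℝ} (hL : 0 < L) (θ : ℝ) (g w : E) :
    θ * ⟪g, w⟫ ≤ L / 2 * ‖w‖ ^ 2 + θ ^ 2 * ‖g‖ ^ 2 / (2 * L) := by
  have h : 0 ≤ ‖L • w - θ • g‖ ^ 2 / (2 * L) := by positivity
  rw [norm_sub_sq_real, real_inner_smul_left, real_inner_smul_right, norm_smul, norm_smul, mul_pow,
    mul_pow, Real.norm_eq_abs, Real.norm_eq_abs, sq_abs, sq_abs, real_inner_comm] at h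
  have : (L ^ 2 * ‖w‖ ^ 2 - 2 * (L * (θ * ⟪g, w⟫)) + θ ^ 2 * ‖g‖ ^ 2) / (2 * L) =
      L / 2 * ‖w‖ ^ 2 + θ ^ 2 * ‖g‖ ^ 2 / (2 * L) - θ * ⟪g, w⟫ := by
    field_simp
    ring
  linarith

end InnerProduct

/-- The momentum step of the method keeps `x` on the segment from `y` to the auxiliary point. -/
lemma gogm_momentum_step {E : Type*} [AddCommGroup E] [Module ℝ E] {θ Θ θ₁ Θ₁ c : ℝ}
    (hθ : θ ≠ 0) (hΘ₁ : Θ₁ ≠ 0) {x y z g x₁ y₁ : E}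
    (hxy : Θ • (x - y) = θ • (z - y)) (hy₁ : y₁ = x - c • g)
    (hx₁ : x₁ = y₁ + ((Θ - θ) * θ₁ / (θ * Θ₁)) • (y₁ - y)
        + ((2 * θ ^ 2 - Θ) * θ₁ / (θ * Θ₁)) • (y₁ - x)) :
    Θ₁ • (x₁ - y₁) = θ₁ • (z - (2 * θ * c) • g - y₁) := by
  have hz : z = y + (Θ / θ) • (x - y) := by
    rw [div_eq_inv_mul, mul_smul, hxy, inv_smul_smul₀ hθ, add_sub_cancel]
  rw [hx₁, hz, hy₁]
  match_scalars <;> field_simp <;> ring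

/-- The auxiliary sequence of the generalized optimized gradient method with step weights `θ` and
gradients `g`. -/
noncomputable def gogmAux {E : Type*} [AddCommGroup E] [Module ℝ E] (L : ℝ) (θ : ℕ → ℝ) (x₀ : E)
    (g : ℕ → E) : ℕ → E
  | 0 => x₀
  | i + 1 => gogmAux L θ x₀ g i - (2 * θ i / L) • g i


theorem stmt_8 {d : ℕ} (L R : ℝ) (hL : 0 < L) (hR : 0 < R)
    (f : EuclideanSpace ℝ (Fin d) → ℝ)
    (f' : EuclideanSpace ℝ (Fin d) → EuclideanSpace ℝ (Fin d))
    (hconv : ConvexOn ℝ Set.univ f)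
    (hdiff : ∀ z, HasGradientAt f (f' z) z)
    (hlip : ∀ z w, ‖f' z - f' w‖ ≤ L * ‖z - w‖)
    (xs : EuclideanSpace ℝ (Fin d)) (hmin : ∀ z, f xs ≤ f z)
    (N : ℕ)
    (θ Θ : ℕ → ℝ)
    (hθ0 : θ 0 = 1) (hθpos : ∀ i, i ≤ N → 0 < θ i)
    (hΘ : ∀ i, i < N → Θ i = ∑ l ∈ Finset.range (i + 1), θ l)
    (hΘN : Θ N = 2 * ∑ l ∈ Finset.range N, θ l + θ N)
    (hθΘ : ∀ i, i ≤ N → θ i ^ 2 ≤ Θ i)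
    (x y : ℕ → EuclideanSpace ℝ (Fin d)) (x0 : EuclideanSpace ℝ (Fin d))
    (hx0 : x 0 = x0) (hy0 : y 0 = x0) (hinit : ‖x0 - xs‖ ≤ R)
    (hy : ∀ i, i < N → y (i + 1) = x i - (1 / L) • f' (x i))
    (hx : ∀ i, i < N → x (i + 1) = y (i + 1)
        + ((Θ i - θ i) * θ (i + 1) / (θ i * Θ (i + 1))) • (y (i + 1) - y i)
        + ((2 * θ i ^ 2 - Θ i) * θ (i + 1) / (θ i * Θ (i + 1))) • (y (i + 1) - x i)) :
    f (x N) - f xs ≤ L * R ^ 2 / (2 * Θ N) := by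
  set z := gogmAux L θ x0 (fun i => f' (x i)) with hz
  set S : ℕ → ℝ := fun i => ∑ l ∈ Finset.range i, θ l with hS
  have hΘ_lt (i : ℕ) (hi : i < N) : Θ i = S i + θ i := by
    rw [hΘ i hi, Finset.sum_range_succ]
  have hΘ_last : Θ N = 2 * S N + θ N := hΘN
  have hS_nonneg (i : ℕ) (hi : i ≤ N) : 0 ≤ S i :=
    Finset.sum_nonneg fun l hl => (hθpos l ((Finset.mem_range.1 hl).le.trans hi)).le
  have hΘ_pos (i : ℕ) (hi : i ≤ N) : 0 < Θ i := (pow_pos (hθpos i hi) 2).trans_le (hθΘ i hi)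
  have hcomb (i : ℕ) (hi : i ≤ N) : Θ i • (x i - y i) = θ i • (z i - y i) := by
    induction i with
    | zero => simp [hz, gogmAux, hx0, hy0]
    | succ i ih =>
      have := gogm_momentum_step (hθpos i (by lia)).ne' (hΘ_pos (i + 1) hi).ne' (ih (by lia))
        (hy i hi) (hx i hi)
      rwa [mul_one_div] at this
  have hcomb_inner (i : ℕ) (hi : i ≤ N) :
      (Θ i - θ i) * ⟪f' (x i), y i - x i⟫ + θ i * ⟪f' (x i), xs - x i⟫ =
        - (θ i * ⟪f' (x i), z i - xs⟫) := by
    have h := congrArg (fun v => ⟪f' (x i), v⟫) (hcomb i hi)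
    simp only [real_inner_smul_right, inner_sub_right] at h ⊢
    linear_combination -h
  have hopt (u) : f u + ⟪f' u, xs - u⟫ + ‖f' u‖ ^ 2 / (2 * L) ≤ f xs := by
    have hgrad : f' xs = 0 := by
      have hloc : IsLocalMin f xs := Filter.Eventually.of_forall hmin
      simpa using hloc.hasFDerivAt_eq_zero (hdiff xs).hasFDerivAt
    simpa [hgrad] using hconv.add_inner_gradient_add_sq_le hL hdiff hlip u xs
  -- At `i = 0` the truncated index is harmless, since `S 0 = 0`.
  have hprev (i : ℕ) (hi : i ≤ N) :
      S i * (f (x i) + ⟪f' (x i), y i - x i⟫ + ‖f' (x i)‖ ^ 2 / (2 * L)) ≤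
        S i * (f (x (i - 1)) - ‖f' (x (i - 1))‖ ^ 2 / (2 * L)) := by
    cases i with
    | zero => simp [hS]
    | succ i =>
      refine mul_le_mul_of_nonneg_left ?_ (hS_nonneg _ hi)
      have h := hconv.add_inner_gradient_add_sq_le hL hdiff hlip (x (i + 1)) (x i)
      have hinner : ⟪f' (x (i + 1)), y (i + 1) - x (i + 1)⟫ =
          ⟪f' (x (i + 1)), x i - x (i + 1)⟫ - 2 * ⟪f' (x i), f' (x (i + 1))⟫ / (2 * L) := by
        rw [hy i hi, sub_right_comm, inner_sub_right, real_inner_smul_right,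
          real_inner_comm (f' (x i)) (f' (x (i + 1)))]
        field_simp
      rw [norm_sub_sq_real, add_div, sub_div] at h
      rw [hinner, Nat.add_sub_cancel]
      linarith
  have hlyap (i : ℕ) (hi : i ≤ N) :
      2 * S i * (f (x (i - 1)) - ‖f' (x (i - 1))‖ ^ 2 / (2 * L) - f xs)
        + L / 2 * ‖z i - xs‖ ^ 2 ≤ L / 2 * ‖x0 - xs‖ ^ 2 := by
    induction i with
    | zero => simp [hS, hz, gogmAux]
    | succ i ih =>
      have hθi := hθpos i (by lia)
      have hSi := hΘ_lt i hi
      have hSsucc : S (i + 1) = Θ i := by rw [hSi, hS]; exact Finset.sum_range_succ _ _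
      have hzsucc : z (i + 1) = z i - (2 * θ i / L) • f' (x i) := rfl
      have hstep := half_mul_norm_sub_smul_sub_sq hL.ne' (θ i) (z i) xs (f' (x i))
      rw [hSsucc, hzsucc, hstep, Nat.add_sub_cancel]
      have hc := hcomb_inner i (by lia)
      have ho := mul_le_mul_of_nonneg_left (hopt (x i)) hθi.le
      have hp := hprev i (by lia)
      have hsq := mul_le_mul_of_nonneg_right (hθΘ i (by lia))
        (by positivity : 0 ≤ ‖f' (x i)‖ ^ 2 / (2 * L))
      have hdiv : 2 * θ i ^ 2 * ‖f' (x i)‖ ^ 2 / L =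
          4 * (θ i ^ 2 * (‖f' (x i)‖ ^ 2 / (2 * L))) := by
        field_simp
        ring
      rw [hdiv]
      rw [hSi] at hc hsq ⊢
      linarith [ih (by lia)]
  have hθN := hθpos N le_rfl
  have hc := hcomb_inner N le_rfl
  have ho := mul_le_mul_of_nonneg_left (hopt (x N)) hθN.le
  have hp := hprev N le_rfl
  have hl := hlyap N le_rfl
  have hyoung := mul_inner_le_half_mul_norm_sq_add hL (θ N) (f' (x N)) (z N - xs)
  have hsq := mul_le_mul_of_nonneg_right (hθΘ N le_rfl)
    (by positivity : 0 ≤ ‖f' (x N)‖ ^ 2 / (2 * L))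
  have hinit' : L / 2 * ‖x0 - xs‖ ^ 2 ≤ L / 2 * R ^ 2 := by gcongr
  rw [le_div_iff₀ (mul_pos two_pos (hΘ_pos N le_rfl))]
  rw [mul_div_assoc] at hyoung
  rw [hΘ_last] at hc hsq ⊢
  linarith
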